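/- Let K be a field of characteristic zero, k ≥ 1, and G := y^{k-1}·z^{k+2} ∈ K[x,y,z]. For every integer n with k−1 ≤ n ≤ k+2, the K-vector space spanned by all n-th order partial derivatives of G equals z^{k+2-n}·K[y,z]_{k-1}, i.e., it is spanned by y^{k-1}z^{k+2-n}, …, y·z^{2k-n}, z^{2k+1-n}. -/

import Mathlib

open MvPolynomial

/-- The span of all `n`-th order partial derivatives of a ternary polynomial `F`
(with variables `x = X 0`, `y = X 1`, `z = X 2`). -/
noncomputable def derivSpan (K : Type*) [CommSemiring K] (n : ℕ)
    (F : MvPolynomial (Fin 3) K) : Submodule K (MvPolynomial (Fin 3) K) :=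
  Submodule.span K {G | ∃ i j l : ℕ, i + j + l = n ∧
    G = (⇑(pderiv (0 : Fin 3)))^[i] ((⇑(pderiv (1 : Fin 3)))^[j]
          ((⇑(pderiv (2 : Fin 3)))^[l] F))}

/-- Iterating `∂/∂Xᵢ` on `Xᵢ ^ a * c`, where `c` does not depend on `Xᵢ`. -/
theorem pderiv_iterate_X_pow_mul {σ R : Type*} [CommSemiring R] (i : σ) (a m : ℕ)
    {c : MvPolynomial σ R} (hc : pderiv i c = 0) :
    (⇑(pderiv i))^[m] (X i ^ a * c) = (a.descFactorial m : R) • (X i ^ (a - m) * c) := by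
  induction m with
  | zero => simp
  | succ m ih =>
    rw [Function.iterate_succ_apply', ih, Derivation.map_smul, Derivation.leibniz, hc,
      Derivation.leibniz_pow, pderiv_X_self, Nat.descFactorial_succ, Nat.sub_sub]
    simp only [smul_eq_mul, mul_zero, zero_add, mul_one, nsmul_eq_mul, smul_eq_C_mul,
      Nat.cast_mul, map_mul, map_natCast]
    ring

/-- The partial derivatives of the monomial `y ^ a * z ^ b`. -/
theorem pderiv_iterate_yz {R : Type*} [CommSemiring R] (a b j l : ℕ) :
    (⇑(pderiv (1 : Fin 3)))^[j] ((⇑(pderiv (2 : Fin 3)))^[l]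
        (X 1 ^ a * X 2 ^ b : MvPolynomial (Fin 3) R)) =
      ((b.descFactorial l : R) * (a.descFactorial j : R)) •
        (X 1 ^ (a - j) * X 2 ^ (b - l)) := by
  have hz : pderiv (2 : Fin 3) (X 1 ^ a : MvPolynomial (Fin 3) R) = 0 := by
    simp [Derivation.leibniz_pow]
  have hy : pderiv (1 : Fin 3) (X 2 ^ (b - l) : MvPolynomial (Fin 3) R) = 0 := by
    simp [Derivation.leibniz_pow]
  rw [mul_comm, pderiv_iterate_X_pow_mul _ _ _ hz, mul_comm (X 2 ^ (b - l)),
    mul_smul, ← pderiv_iterate_X_pow_mul 1 a j hy]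
  exact (Function.Commute.iterate_left (fun c => (pderiv (1 : Fin 3)).map_smul _ c) j) _

/-- For `k-1 ≤ n ≤ k+2`, the span of the `n`-th order partial derivatives of
`G = y^{k-1}·z^{k+2}` is spanned by the monomials
`y^{k-1}·z^{k+2-n}, …, y·z^{2k-n}, z^{2k+1-n}`. -/
theorem derivSpan_of_G_high (K : Type*) [Field K] [CharZero K]
    (k : ℕ) (hk : 1 ≤ k) (n : ℕ) (hn1 : k - 1 ≤ n) (hn2 : n ≤ k + 2) :
    derivSpan K n (X 1 ^ (k - 1) * X 2 ^ (k + 2) : MvPolynomial (Fin 3) K) =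
      Submodule.span K
        {P | ∃ j ≤ k - 1, P = (X 1 ^ j * X 2 ^ (2 * k + 1 - n - j) :
          MvPolynomial (Fin 3) K)} := by
  apply le_antisymm
  · refine Submodule.span_le.2 ?_
    rintro _ ⟨i, j, l, hijl, rfl⟩
    rw [pderiv_iterate_yz]
    rcases Nat.eq_zero_or_pos i with rfl | hi
    · rw [Function.iterate_zero_apply]
      rcases le_or_gt j (k - 1) with hj | hj
      · refine Submodule.smul_mem _ _ (Submodule.subset_span ⟨k - 1 - j, by omega, ?_⟩)
        rw [show 2 * k + 1 - n - (k - 1 - j) = k + 2 - l by omega]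
      · simp [Nat.descFactorial_of_lt hj]
    · obtain ⟨i, rfl⟩ := Nat.exists_eq_add_of_lt hi
      have h0 : pderiv (0 : Fin 3) (X 1 ^ (k - 1 - j) * X 2 ^ (k + 2 - l) :
          MvPolynomial (Fin 3) K) = 0 := by
        simp [Derivation.leibniz, Derivation.leibniz_pow]
      rw [zero_add, Function.iterate_succ_apply, Derivation.map_smul, h0, smul_zero, iterate_map_zero]
      exact Submodule.zero_mem _
  · refine Submodule.span_le.2 ?_
    rintro _ ⟨m, hm, rfl⟩
    have hne : (((k + 2).descFactorial (n - (k - 1 - m)) : K) *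
        ((k - 1).descFactorial (k - 1 - m) : K)) ≠ 0 := by
      refine mul_ne_zero ?_ ?_ <;>
      · rw [Nat.cast_ne_zero, Ne, Nat.descFactorial_eq_zero_iff_lt]
        omega
    refine (Submodule.smul_mem_iff _ hne).1 (Submodule.subset_span
      ⟨0, k - 1 - m, n - (k - 1 - m), by omega, ?_⟩)
    rw [Function.iterate_zero_apply, pderiv_iterate_yz,
      show k - 1 - (k - 1 - m) = m by omega,
      show k + 2 - (n - (k - 1 - m)) = 2 * k + 1 - n - m by omega]
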